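/- There is an absolute constant C > 0 such that the following holds: for every integer k ≥ 3 and every weighted multigraph on a vertex set V with |V| = n ≥ k in which every medium cut has shoresize at most k, the number of medium cuts is at most k^{C·k} · n. -/

import Mathlib

open Finset

/-- The weight of a `k`-cut, viewed as a finite partition `P` of the vertex set:
the sum of `w u v` over unordered pairs `{u, v}` lying in different parts. -/
noncomputable def kCutWeight {V : Type*} [Fintype V] [DecidableEq V] (w : V → V → ℝ)
    (P : Finpartition (univ : Finset V)) : ℝ :=
  (1 / 2) * ∑ u, ∑ v, if ∃ p ∈ P.parts, u ∈ p ∧ v ∈ p then (0 : ℝ) else w u v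

/-- The weight `∂S` of the 2-cut with shore `S`: the total weight of edges crossing
from `S` to its complement. -/
noncomputable def cutW {V : Type*} [Fintype V] [DecidableEq V] (w : V → V → ℝ)
    (S : Finset V) : ℝ :=
  ∑ u ∈ S, ∑ v ∈ Sᶜ, w u v

lemma exists_subfamily_separating {V : Type*} [DecidableEq V] (𝒮 : Finset (Finset V))
    (X : Finset V) (hX : X.Nonempty)
    (hsep : ∀ x ∈ X, ∀ y ∈ X, x ≠ y → ∃ S ∈ 𝒮, ¬(x ∈ S ↔ y ∈ S)) :
    ∃ 𝒢 ⊆ 𝒮, #𝒢 + 1 ≤ #X ∧ ∀ x ∈ X, ∀ y ∈ X, x ≠ y → ∃ S ∈ 𝒢, ¬(x ∈ S ↔ y ∈ S) := by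
  induction hX using Finset.Nonempty.cons_induction with
  | singleton a => exact ⟨∅, by simp, by simp, by simp⟩
  | cons a s ha hs ih =>
    obtain ⟨𝒢, hsub, hcard, h𝒢⟩ := ih fun x hx y hy =>
      hsep x (mem_cons_of_mem hx) y (mem_cons_of_mem hy)
    by_cases hy : ∃ y ∈ s, ∀ S ∈ 𝒢, (a ∈ S ↔ y ∈ S)
    · obtain ⟨y, hys, hy⟩ := hy
      obtain ⟨T, hT, hTay⟩ := hsep a (mem_cons_self a s) y (mem_cons_of_mem hys)
        (by rintro rfl; exact ha hys)
      have haz : ∀ z ∈ s, ∃ S ∈ insert T 𝒢, ¬(a ∈ S ↔ z ∈ S) := by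
        intro z hz
        by_cases hzy : z = y
        · exact ⟨T, mem_insert_self _ _, hzy ▸ hTay⟩
        · obtain ⟨S, hS, h⟩ := h𝒢 z hz y hys hzy
          exact ⟨S, mem_insert_of_mem hS, by have := hy S hS; tauto⟩
      refine ⟨insert T 𝒢, insert_subset hT hsub, ?_, ?_⟩
      · have := card_insert_le T 𝒢
        rw [card_cons]; omega
      · intro x hx z hz hxz
        rcases mem_cons.1 hx with rfl | hxs <;> rcases mem_cons.1 hz with rfl | hzs
        · exact absurd rfl hxz
        · exact haz z hzs
        · obtain ⟨S, hS, h⟩ := haz x hxs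
          exact ⟨S, hS, by tauto⟩
        · obtain ⟨S, hS, h⟩ := h𝒢 x hxs z hzs hxz
          exact ⟨S, mem_insert_of_mem hS, h⟩
    · push Not at hy
      refine ⟨𝒢, hsub, by rw [card_cons]; omega, ?_⟩
      have haz : ∀ z ∈ s, ∃ S ∈ 𝒢, ¬(a ∈ S ↔ z ∈ S) := by
        intro z hz
        obtain ⟨S, hS, h⟩ := hy z hz
        exact ⟨S, hS, by tauto⟩
      intro x hx z hz hxz
      rcases mem_cons.1 hx with rfl | hxs <;> rcases mem_cons.1 hz with rfl | hzs
      · exact absurd rfl hxz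
      · exact haz z hzs
      · obtain ⟨S, hS, h⟩ := haz x hxs
        exact ⟨S, hS, by tauto⟩
      · exact h𝒢 x hxs z hzs hxz

lemma exists_sunflower {V : Type*} [DecidableEq V] (r b m : ℕ) (hm : m ≤ b)
    (F : Finset (Finset V)) (hF : ∀ S ∈ F, #S ≤ m) (hcard : (r * b + 1) ^ m < #F) :
    ∃ G ⊆ F, ∃ C : Finset V, r ≤ #G ∧ (∀ S ∈ G, C ⊆ S) ∧
      ∀ S ∈ G, ∀ T ∈ G, S ≠ T → S ∩ T = C := by
  induction m generalizing F with
  | zero =>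
    have : F ⊆ {∅} := fun S hS => by
      simpa using hF S hS
    have := card_le_card this
    simp at *; omega
  | succ m ih =>
    obtain ⟨G, hGmem, hGmax⟩ := (F.powerset.filter
      fun G => ∀ S ∈ G, ∀ T ∈ G, S ≠ T → Disjoint S T).exists_max_image card ⟨∅, by simp⟩
    simp only [mem_filter, mem_powerset] at hGmem hGmax
    obtain ⟨hGF, hG⟩ := hGmem
    by_cases hr : r ≤ #G
    · exact ⟨G, hGF, ∅, hr, by simp, fun S hS T hT h => disjoint_iff_inter_eq_empty.1 (hG S hS T hT h)⟩
    set U := G.biUnion id with hU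
    have hUcard : #U ≤ r * b := by
      calc #U ≤ #G * (m + 1) := card_biUnion_le_card_mul _ _ _ fun S hS => hF S (hGF hS)
        _ ≤ r * b := Nat.mul_le_mul (by omega) hm
    have hmeet : ∀ S ∈ F.erase ∅, ∃ x ∈ U, x ∈ S := by
      intro S hS
      obtain ⟨hS0, hSF⟩ := mem_erase.1 hS
      by_contra! hdis
      have hSG : S ∉ G := fun h => by
        obtain ⟨x, hx⟩ := nonempty_iff_ne_empty.2 hS0
        exact hdis x (mem_biUnion.2 ⟨S, h, hx⟩) hx
      have hd : ∀ T ∈ G, Disjoint S T := fun T hT =>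
        disjoint_left.2 fun x hx hxT => hdis x (mem_biUnion.2 ⟨T, hT, hxT⟩) hx
      have := hGmax (insert S G) ⟨insert_subset hSF hGF, by
        intro A hA B hB hAB
        rcases mem_insert.1 hA with rfl | hA' <;> rcases mem_insert.1 hB with rfl | hB'
        · exact absurd rfl hAB
        · exact hd B hB'
        · exact (hd A hA').symm
        · exact hG A hA' B hB' hAB⟩
      rw [card_insert_of_notMem hSG] at this
      omega
    have hx : ∃ x ∈ U, (r * b + 1) ^ m < #(F.filter (x ∈ ·)) := by
      by_contra! hle
      have h1 : #(F.erase ∅) ≤ #(U.biUnion fun x => F.filter (x ∈ ·)) :=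
        card_le_card fun S hS => by
          obtain ⟨x, hxU, hxS⟩ := hmeet S hS
          exact mem_biUnion.2 ⟨x, hxU, mem_filter.2 ⟨mem_of_mem_erase hS, hxS⟩⟩
      have h2 := card_biUnion_le_card_mul U _ _ hle
      have h3 := pred_card_le_card_erase (s := F) (a := ∅)
      have h4 : #U * (r * b + 1) ^ m ≤ r * b * (r * b + 1) ^ m := Nat.mul_le_mul_right _ hUcard
      have h5 : 1 ≤ (r * b + 1) ^ m := Nat.one_le_pow _ _ (by omega)
      rw [pow_succ] at hcard
      have h6 : (r * b + 1) ^ m * (r * b + 1) = r * b * (r * b + 1) ^ m + (r * b + 1) ^ m := by ring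
      omega
    obtain ⟨x, -, hx⟩ := hx
    have hinj : Set.InjOn (fun S : Finset V => S.erase x) (F.filter (x ∈ ·) : Finset (Finset V)) :=
      fun S hS T hT h => by
        simp only [coe_filter, Set.mem_ofPred_eq] at hS hT
        rw [← insert_erase hS.2, ← insert_erase hT.2]
        exact congrArg _ h
    obtain ⟨G, hGsub, C, hrG, hC, hGC⟩ := ih (by omega) ((F.filter (x ∈ ·)).image fun S => S.erase x)
      (by
        simp only [mem_image, mem_filter]
        rintro _ ⟨S, ⟨hS, hxS⟩, rfl⟩
        have := hF S hS
        rw [card_erase_of_mem hxS]; omega)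
      (by rwa [card_image_of_injOn hinj])
    have hG : ∀ S ∈ G, x ∉ S ∧ insert x S ∈ F := by
      intro S hS
      obtain ⟨T, hT, rfl⟩ := mem_image.1 (hGsub hS)
      obtain ⟨hT, hxT⟩ := mem_filter.1 hT
      exact ⟨notMem_erase _ _, by rwa [insert_erase hxT]⟩
    refine ⟨G.image (insert x), ?_, insert x C, ?_, ?_, ?_⟩
    · intro S hS
      obtain ⟨T, hT, rfl⟩ := mem_image.1 hS
      exact (hG T hT).2
    · rw [card_image_of_injOn]
      · exact hrG
      · intro S hS T hT h
        rw [← erase_insert (hG S hS).1, ← erase_insert (hG T hT).1, h]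
    · intro S hS
      obtain ⟨T, hT, rfl⟩ := mem_image.1 hS
      exact insert_subset_insert _ (hC T hT)
    · intro S hS T hT hne
      obtain ⟨S', hS', rfl⟩ := mem_image.1 hS
      obtain ⟨T', hT', rfl⟩ := mem_image.1 hT
      rw [← insert_inter_distrib, hGC S' hS' T' hT' (by rintro rfl; exact hne rfl)]

section

variable {V : Type*} [Fintype V] [DecidableEq V]

lemma cutW_eq_sum_ite (w : V → V → ℝ) (hsymm : ∀ u v, w u v = w v u) (S : Finset V) :
    cutW w S = (1 / 2) * ∑ u, ∑ v, if u ∈ S ↔ v ∈ S then 0 else w u v := by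
  have h1 : ∀ (A B : Finset V), ∑ u ∈ A, ∑ v ∈ B, w u v
      = ∑ u, ∑ v, if u ∈ A ∧ v ∈ B then w u v else 0 := by
    intro A B
    simp only [ite_and, sum_ite_irrel, sum_const_zero, sum_ite_mem, univ_inter]
  have h2 : cutW w S = ∑ u ∈ Sᶜ, ∑ v ∈ S, w u v := by
    rw [cutW, sum_comm]
    exact sum_congr rfl fun u _ => sum_congr rfl fun v _ => hsymm _ _
  have h3 : cutW w S + cutW w S = ∑ u, ∑ v, if u ∈ S ↔ v ∈ S then 0 else w u v := by
    conv_lhs => arg 2; rw [h2]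
    rw [cutW, h1, h1, ← sum_add_distrib]
    refine sum_congr rfl fun u _ => ?_
    rw [← sum_add_distrib]
    refine sum_congr rfl fun v _ => ?_
    by_cases hu : u ∈ S <;> by_cases hv : v ∈ S <;> simp [hu, hv]
  linarith

lemma cutW_compl (w : V → V → ℝ) (hsymm : ∀ u v, w u v = w v u) (S : Finset V) :
    cutW w Sᶜ = cutW w S := by
  rw [cutW, cutW, compl_compl, sum_comm]
  exact sum_congr rfl fun u _ => sum_congr rfl fun v _ => hsymm _ _

/-- A family of 2-cuts separating `k` vertices from each other refines to a `k`-cut, whose weight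
is at most the total weight of the family. -/
lemma exists_kCut_le_sum_cutW (w : V → V → ℝ) (hsymm : ∀ u v, w u v = w v u)
    (hnonneg : ∀ u v, 0 ≤ w u v) (𝒢 : Finset (Finset V)) (X : Finset V) (hX : X.Nonempty)
    (hsep : ∀ x ∈ X, ∀ y ∈ X, x ≠ y → ∃ S ∈ 𝒢, ¬(x ∈ S ↔ y ∈ S)) :
    ∃ P : Finpartition (univ : Finset V), #P.parts = #X ∧
      kCutWeight w P ≤ ∑ S ∈ 𝒢, cutW w S := by
  classical
  obtain ⟨x₀, hx₀⟩ := hX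
  let same : V → V → Prop := fun u v => ∀ S ∈ 𝒢, (u ∈ S ↔ v ∈ S)
  have hsame : ∀ x ∈ X, ∀ y ∈ X, same x y → x = y := by
    intro x hx y hy h
    by_contra hne
    obtain ⟨S, hS, hS'⟩ := hsep x hx y hy hne
    exact hS' (h S hS)
  let g : V → V := fun v => if h : ∃ x ∈ X, same x v then h.choose else x₀
  have hgX : ∀ v, g v ∈ X := by
    intro v
    by_cases h : ∃ x ∈ X, same x v
    · simp only [g, dif_pos h]; exact h.choose_spec.1
    · simp only [g, dif_neg h]; exact hx₀
  have hgx : ∀ x ∈ X, g x = x := by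
    intro x hx
    have h : ∃ y ∈ X, same y x := ⟨x, hx, fun _ _ => Iff.rfl⟩
    simp only [g, dif_pos h]
    exact hsame _ h.choose_spec.1 _ hx h.choose_spec.2
  have hguv : ∀ u v, same u v → g u = g v := by
    intro u v huv
    have : (fun x => x ∈ X ∧ same x u) = fun x => x ∈ X ∧ same x v := by
      funext x
      refine propext (and_congr_right fun _ => forall₂_congr fun S hS => ?_)
      rw [huv S hS]
    simp only [g, this]
  let fib : V → Finset V := fun x => univ.filter (g · = x)
  let P : Finpartition (univ : Finset V) :=
    { parts := X.image fib
      supIndep := by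
        rw [supIndep_iff_pairwiseDisjoint]
        intro A hA B hB hAB
        obtain ⟨x, hx, rfl⟩ := mem_image.1 (mem_coe.1 hA)
        obtain ⟨y, hy, rfl⟩ := mem_image.1 (mem_coe.1 hB)
        refine disjoint_left.2 fun v hv hv' => hAB ?_
        simp only [fib, id, mem_filter] at hv hv'
        rw [← hv.2, ← hv'.2]
      sup_parts := by
        refine eq_univ_of_forall fun v => ?_
        rw [mem_sup]
        exact ⟨fib (g v), mem_image_of_mem _ (hgX v), by simp [fib]⟩
      bot_notMem := by
        intro h
        obtain ⟨x, hx, hfx⟩ := mem_image.1 h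
        have : x ∈ fib x := by simp [fib, hgx x hx]
        rw [hfx] at this
        simp at this }
  refine ⟨P, card_image_of_injOn fun x hx y hy hxy => ?_, ?_⟩
  · have : x ∈ fib x := by simp [fib, hgx x hx]
    rw [show fib x = fib y from hxy] at this
    simpa [fib, hgx x hx] using this
  · simp only [cutW_eq_sum_ite w hsymm, ← mul_sum]
    refine mul_le_mul_of_nonneg_left ?_ (by norm_num)
    rw [sum_comm (s := 𝒢)]
    refine sum_le_sum fun u _ => ?_
    rw [sum_comm (s := 𝒢)]
    refine sum_le_sum fun v _ => ?_
    have hterm : ∀ S ∈ 𝒢, (0 : ℝ) ≤ if u ∈ S ↔ v ∈ S then 0 else w u v := fun S _ => by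
      split_ifs <;> simp [hnonneg]
    split_ifs with h
    · exact sum_nonneg hterm
    · have huv : ¬ same u v := fun huv => h
        ⟨fib (g u), mem_image_of_mem _ (hgX u), by simp [fib], by simp [fib, hguv u v huv]⟩
      simp only [same] at huv
      push Not at huv
      obtain ⟨S, hS, hSuv⟩ := huv
      calc w u v = if u ∈ S ↔ v ∈ S then 0 else w u v := by rw [if_neg (by tauto)]
        _ ≤ _ := single_le_sum hterm hS

lemma cutW_union (w : V → V → ℝ) (hsymm : ∀ u v, w u v = w v u) {C P : Finset V}
    (h : Disjoint C P) :
    cutW w (C ∪ P) + 2 * ∑ u ∈ C, ∑ v ∈ P, w u v = cutW w C + cutW w P := by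
  have hC : Cᶜ = P ∪ (C ∪ P)ᶜ := by
    ext v
    have : v ∈ C → v ∉ P := fun hv => disjoint_left.1 h hv
    simp only [mem_compl, mem_union]; tauto
  have hP : Pᶜ = C ∪ (C ∪ P)ᶜ := by
    ext v
    have : v ∈ C → v ∉ P := fun hv => disjoint_left.1 h hv
    simp only [mem_compl, mem_union]; tauto
  have hd1 : Disjoint P (C ∪ P)ᶜ := disjoint_compl_right.mono_left subset_union_right
  have hd2 : Disjoint C (C ∪ P)ᶜ := disjoint_compl_right.mono_left subset_union_left
  have e : ∑ u ∈ P, ∑ v ∈ C, w u v = ∑ u ∈ C, ∑ v ∈ P, w u v := by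
    rw [sum_comm]
    exact sum_congr rfl fun u _ => sum_congr rfl fun v _ => hsymm _ _
  simp only [cutW]
  rw [sum_union h, hC, hP]
  simp only [sum_union hd1, sum_union hd2, sum_add_distrib, e]
  ring

lemma sum_cutW_sunflower (w : V → V → ℝ) (hsymm : ∀ u v, w u v = w v u)
    (hnonneg : ∀ u v, 0 ≤ w u v) (G : Finset (Finset V)) (C : Finset V)
    (hC : ∀ S ∈ G, C ⊆ S) (hG : ∀ S ∈ G, ∀ T ∈ G, S ≠ T → S ∩ T = C) :
    (#G : ℝ) * cutW w C + ∑ S ∈ G, cutW w (S \ C) ≤ ∑ S ∈ G, cutW w S + 2 * cutW w C := by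
  have h1 : ∀ S ∈ G, cutW w S + 2 * ∑ u ∈ C, ∑ v ∈ S \ C, w u v
      = cutW w C + cutW w (S \ C) := fun S hS => by
    have := cutW_union w hsymm (disjoint_sdiff : Disjoint C (S \ C))
    rwa [union_sdiff_of_subset (hC S hS)] at this
  have h2 := sum_congr rfl h1
  rw [sum_add_distrib, sum_add_distrib, ← mul_sum, sum_const, nsmul_eq_mul] at h2
  have h3 : ∑ S ∈ G, ∑ u ∈ C, ∑ v ∈ S \ C, w u v ≤ cutW w C := by
    rw [sum_comm]
    refine sum_le_sum fun u _ => ?_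
    rw [← sum_biUnion]
    · refine sum_le_sum_of_subset_of_nonneg ?_ fun v _ _ => hnonneg u v
      intro v hv
      obtain ⟨S, _, hv⟩ := mem_biUnion.1 hv
      exact mem_compl.2 (mem_sdiff.1 hv).2
    · intro S hS T hT hne
      refine disjoint_left.2 fun v hv hv' => ?_
      rw [mem_sdiff] at hv hv'
      exact hv.2 (hG S hS T hT hne ▸ mem_inter.2 ⟨hv.1, hv'.1⟩)
  linarith

/-- Fewer than `k` vertices can be pairwise separated by cuts of weight less than
`lam / (k - 1)`. -/
lemma card_lt_of_separated_by_small_cuts (w : V → V → ℝ) (hsymm : ∀ u v, w u v = w v u)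
    (hnonneg : ∀ u v, 0 ≤ w u v) {k : ℕ} (hk : 2 ≤ k) {lam : ℝ}
    (hlam : ∀ P : Finpartition (univ : Finset V), #P.parts = k → lam ≤ kCutWeight w P)
    (X : Finset V)
    (hsep : ∀ x ∈ X, ∀ y ∈ X, x ≠ y → ∃ S, cutW w S < lam / ((k : ℝ) - 1) ∧ ¬(x ∈ S ↔ y ∈ S)) :
    #X < k := by
  by_contra! hle
  obtain ⟨Y, hYX, hY⟩ := exists_subset_card_eq hle
  have hYne : Y.Nonempty := card_pos.1 (by omega)
  obtain ⟨𝒢, hsub, hcard, h𝒢⟩ := exists_subfamily_separating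
    (univ.filter fun S => cutW w S < lam / ((k : ℝ) - 1)) Y hYne (by
      intro x hx y hy hxy
      obtain ⟨S, hS, h⟩ := hsep x (hYX hx) y (hYX hy) hxy
      exact ⟨S, by simpa using hS, h⟩)
  obtain ⟨P, hP, hPw⟩ := exists_kCut_le_sum_cutW w hsymm hnonneg 𝒢 Y hYne h𝒢
  have hk1 : (0 : ℝ) < (k : ℝ) - 1 := by
    have : (2 : ℝ) ≤ k := by exact_mod_cast hk
    linarith
  have hne : 𝒢.Nonempty := by
    obtain ⟨x, hx, y, hy, hxy⟩ := one_lt_card.1 (show 1 < #Y by omega)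
    obtain ⟨S, hS, -⟩ := h𝒢 x hx y hy hxy
    exact ⟨S, hS⟩
  have hsmall : ∀ S ∈ 𝒢, cutW w S < lam / ((k : ℝ) - 1) := fun S hS => by
    simpa using hsub hS
  have hpos : 0 ≤ lam / ((k : ℝ) - 1) := by
    obtain ⟨S, hS⟩ := hne
    exact (sum_nonneg fun u _ => sum_nonneg fun v _ => hnonneg u v).trans (hsmall S hS).le
  have h1 : ∑ S ∈ 𝒢, cutW w S < #𝒢 * (lam / ((k : ℝ) - 1)) := by
    simpa using sum_lt_sum_of_nonempty hne hsmall
  have h2 : (#𝒢 : ℝ) * (lam / ((k : ℝ) - 1)) ≤ lam := by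
    have : (#𝒢 : ℝ) ≤ (k : ℝ) - 1 := by
      have : #𝒢 + 1 ≤ k := by omega
      have : ((#𝒢 + 1 : ℕ) : ℝ) ≤ k := by exact_mod_cast this
      push_cast at this; linarith
    calc (#𝒢 : ℝ) * (lam / ((k : ℝ) - 1)) ≤ ((k : ℝ) - 1) * (lam / ((k : ℝ) - 1)) :=
          mul_le_mul_of_nonneg_right this hpos
      _ = lam := by field_simp
  have := hlam P (by omega)
  linarith

/-- Sets that split no pair of vertices left together by a family `𝒮` are determined by the
classes they meet. -/
lemma card_filter_unions_le (𝒮 : Finset (Finset V)) (k : ℕ)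
    (hsep : ∀ X : Finset V, (∀ x ∈ X, ∀ y ∈ X, x ≠ y → ∃ S ∈ 𝒮, ¬(x ∈ S ↔ y ∈ S)) → #X < k) :
    #(univ.filter fun T : Finset V =>
      ∀ u v, (∀ S ∈ 𝒮, (u ∈ S ↔ v ∈ S)) → u ∈ T → v ∈ T) ≤ 2 ^ k := by
  classical
  let s : Setoid V :=
    { r := fun u v => ∀ S ∈ 𝒮, (u ∈ S ↔ v ∈ S)
      iseqv := ⟨fun _ _ _ => Iff.rfl, fun h S hS => (h S hS).symm,
        fun h h' S hS => (h S hS).trans (h' S hS)⟩ }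
  have hq : Fintype.card (Quotient s) < k := by
    rw [← card_univ, ← card_image_of_injective univ Quotient.out_injective]
    refine hsep _ fun x hx y hy hxy => ?_
    obtain ⟨a, -, rfl⟩ := mem_image.1 hx
    obtain ⟨b, -, rfl⟩ := mem_image.1 hy
    by_contra! h
    exact hxy (congrArg _ (Quotient.out_equiv_out.1 h))
  calc _ ≤ #(univ : Finset (Finset (Quotient s))) := by
        refine card_le_card_of_injOn (fun T => T.image (Quotient.mk s)) (by simp) ?_
        intro T hT T' hT' h
        simp only [coe_filter, mem_univ, true_and, Set.mem_ofPred_eq] at hT hT'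
        have key : ∀ A B : Finset V,
            (∀ u v, (∀ S ∈ 𝒮, (u ∈ S ↔ v ∈ S)) → u ∈ B → v ∈ B) →
            A.image (Quotient.mk s) = B.image (Quotient.mk s) → A ⊆ B := by
          intro A B hB hAB v hv
          have := mem_image_of_mem (Quotient.mk s) hv
          rw [hAB] at this
          obtain ⟨u, hu, huv⟩ := mem_image.1 this
          exact hB u v (Quotient.exact huv) hu
        exact (key T T' hT' h).antisymm (key T' T hT h.symm)
    _ = 2 ^ Fintype.card (Quotient s) := by rw [card_univ, Fintype.card_finset]
    _ ≤ 2 ^ k := Nat.pow_le_pow_right (by norm_num) hq.le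

lemma card_splitting_cuts_at_vertex_le (w : V → V → ℝ) (hsymm : ∀ u v, w u v = w v u)
    (hnonneg : ∀ u v, 0 ≤ w u v) {k : ℕ} (hk : 2 ≤ k) {lam : ℝ}
    (hlam : ∀ P : Finpartition (univ : Finset V), #P.parts = k → lam ≤ kCutWeight w P)
    (v : V) (F : Finset (Finset V)) (hFcard : ∀ S ∈ F, #S ≤ k)
    (hFw : ∀ S ∈ F, cutW w S < 2 * lam / k) (hFv : ∀ S ∈ F, v ∈ S)
    (hF : ∀ S ∈ F, ∃ u, (∀ T, cutW w T < lam / ((k : ℝ) - 1) → (v ∈ T ↔ u ∈ T)) ∧ u ∉ S) :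
    #F ≤ (2 * k * k + 1) ^ k := by
  by_contra! hlt
  obtain ⟨G, hGF, C, hGcard, hC, hGC⟩ := exists_sunflower (2 * k) k k le_rfl F hFcard hlt
  obtain ⟨A, hA, B, hB, hAB⟩ := one_lt_card.1 (show 1 < #G by omega)
  have hvC : v ∈ C := hGC A hA B hB hAB ▸ mem_inter.2 ⟨hFv A (hGF hA), hFv B (hGF hB)⟩
  have hCbig : lam / ((k : ℝ) - 1) ≤ cutW w C := by
    by_contra! h
    obtain ⟨u, hu, huA⟩ := hF A (hGF hA)
    exact huA (hC A hA ((hu C h).1 hvC))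
  set small := (G.erase C).filter fun S => cutW w (S \ C) < lam / ((k : ℝ) - 1) with hsmall
  set big := (G.erase C).filter fun S => ¬ cutW w (S \ C) < lam / ((k : ℝ) - 1) with hbig
  have hdisj : ∀ S ∈ G, ∀ T ∈ G, ∀ x, x ∈ S \ C → x ∈ T → S = T := by
    intro S hS T hT x hx hxT
    by_contra hne
    exact (mem_sdiff.1 hx).2 (hGC S hS T hT hne ▸ mem_inter.2 ⟨(mem_sdiff.1 hx).1, hxT⟩)
  have hsmallcard : #small < k := by
    have hex : ∀ S ∈ small, ∃ x, x ∈ S \ C := by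
      intro S hS
      obtain ⟨hSC, hSG⟩ := mem_erase.1 (mem_filter.1 hS).1
      exact sdiff_nonempty.2 fun h => hSC (h.antisymm (hC S hSG))
    have : Nonempty V := ⟨v⟩
    choose! f hf using hex
    have hsG : ∀ S ∈ small, S ∈ G := fun S hS => mem_of_mem_erase (mem_filter.1 hS).1
    have hinj : Set.InjOn f small := fun S hS T hT h =>
      hdisj S (hsG S hS) T (hsG T hT) (f S) (hf S hS) (h ▸ (mem_sdiff.1 (hf T hT)).1)
    rw [← card_image_of_injOn hinj]
    refine card_lt_of_separated_by_small_cuts w hsymm hnonneg hk hlam _ fun x hx y hy hxy => ?_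
    obtain ⟨S, hS, rfl⟩ := mem_image.1 hx
    obtain ⟨T, hT, rfl⟩ := mem_image.1 hy
    refine ⟨S \ C, (mem_filter.1 hS).2, fun h => hxy ?_⟩
    rw [hdisj S (hsG S hS) T (hsG T hT) (f T) (h.1 (hf S hS)) (mem_sdiff.1 (hf T hT)).1]
  have hsum : #small + #big = #(G.erase C) := card_filter_add_card_filter_not _
  have hpred := pred_card_le_card_erase (s := G) (a := C)
  obtain ⟨H, hHbig, hHcard⟩ := exists_subset_card_eq (show k ≤ #big by omega)
  have hHG : ∀ S ∈ H, S ∈ G := fun S hS => mem_of_mem_erase (mem_filter.1 (hHbig hS)).1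
  have hmain := sum_cutW_sunflower w hsymm hnonneg H C (fun S hS => hC S (hHG S hS))
    fun S hS T hT => hGC S (hHG S hS) T (hHG T hT)
  have hk2 : (2 : ℝ) ≤ k := by exact_mod_cast hk
  have hHne : H.Nonempty := card_pos.1 (by omega)
  have hup : ∑ S ∈ H, cutW w S < 2 * lam := by
    calc ∑ S ∈ H, cutW w S < ∑ _S ∈ H, 2 * lam / k :=
          sum_lt_sum_of_nonempty hHne fun S hS => hFw S (hGF (hHG S hS))
      _ = 2 * lam := by
          rw [sum_const, hHcard, nsmul_eq_mul]; field_simp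
  have hlow : (k : ℝ) * (lam / ((k : ℝ) - 1)) ≤ ∑ S ∈ H, cutW w (S \ C) := by
    calc (k : ℝ) * (lam / ((k : ℝ) - 1)) = ∑ _S ∈ H, lam / ((k : ℝ) - 1) := by
          rw [sum_const, hHcard, nsmul_eq_mul]
      _ ≤ _ := sum_le_sum fun S hS => not_lt.1 (mem_filter.1 (hHbig hS)).2
  have hcore : ((k : ℝ) - 2) * (lam / ((k : ℝ) - 1)) ≤ ((k : ℝ) - 2) * cutW w C :=
    mul_le_mul_of_nonneg_left hCbig (by linarith)
  have hid : ((k : ℝ) - 1) * (lam / ((k : ℝ) - 1)) = lam :=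
    mul_div_cancel₀ _ (by linarith)
  rw [hHcard] at hmain
  linarith

end

/-- There is an absolute constant `C > 0` such that for every integer `k ≥ 3` and every
weighted multigraph on a vertex set `V` with `|V| = n ≥ k`, the number of medium cuts
(counted as unordered pairs `{S, Sᶜ}` with `λ_k/(k-1) ≤ ∂S < 2λ_k/k`) is at most
`k^(C·k) · n`, provided every medium cut has shoresize at most `k`. -/
theorem number_of_medium_cuts_small_shores :
    ∃ C : ℝ, 0 < C ∧
      ∀ (k : ℕ) (V : Type) [Fintype V] [DecidableEq V] (w : V → V → ℝ) (lam : ℝ),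
        3 ≤ k →
        k ≤ Fintype.card V →
        (∀ u v, w u v = w v u) →
        (∀ u v, 0 ≤ w u v) →
        (∀ v, w v v = 0) →
        (∃ P : Finpartition (univ : Finset V), P.parts.card = k ∧ kCutWeight w P = lam) →
        (∀ P : Finpartition (univ : Finset V), P.parts.card = k → lam ≤ kCutWeight w P) →
        (∀ S : Finset V, S.Nonempty → Sᶜ.Nonempty →
          lam / ((k : ℝ) - 1) ≤ cutW w S → cutW w S < 2 * lam / k →
          min S.card Sᶜ.card ≤ k) →
        ({p : Finset (Finset V) | ∃ S : Finset V, p = {S, Sᶜ} ∧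
            S.Nonempty ∧ Sᶜ.Nonempty ∧
            lam / ((k : ℝ) - 1) ≤ cutW w S ∧ cutW w S < 2 * lam / k}.ncard : ℝ) ≤
          (k : ℝ) ^ (C * k) * (Fintype.card V : ℝ) := by
  classical
  refine ⟨4, by norm_num, ?_⟩
  intro k V _ _ w lam hk hn hsymm hnonneg _ _ hlam hshore
  have hk2 : 2 ≤ k := by omega
  let M : Finset (Finset V) := univ.filter fun S => #S ≤ k ∧ cutW w S < 2 * lam / k
  let 𝒮 : Finset (Finset V) := univ.filter fun S => cutW w S < lam / ((k : ℝ) - 1)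
  let unions : Finset (Finset V) := univ.filter fun T =>
    ∀ u v, (∀ S ∈ 𝒮, (u ∈ S ↔ v ∈ S)) → u ∈ T → v ∈ T
  let F : V → Finset (Finset V) := fun v => M.filter fun S =>
    v ∈ S ∧ ∃ u, (∀ T ∈ 𝒮, (v ∈ T ↔ u ∈ T)) ∧ u ∉ S
  have hunions : #unions ≤ 2 ^ k := by
    refine card_filter_unions_le 𝒮 k fun X hX => ?_
    refine card_lt_of_separated_by_small_cuts w hsymm hnonneg hk2 hlam X fun x hx y hy hxy => ?_
    obtain ⟨S, hS, h⟩ := hX x hx y hy hxy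
    exact ⟨S, (mem_filter.1 hS).2, h⟩
  have hFle : ∀ v, #(F v) ≤ (2 * k * k + 1) ^ k := by
    intro v
    refine card_splitting_cuts_at_vertex_le w hsymm hnonneg hk2 hlam v (F v) ?_ ?_ ?_ ?_
    all_goals
      intro S hS
      obtain ⟨hM, hv, u, hu, huS⟩ := mem_filter.1 hS
      obtain ⟨-, hScard, hSw⟩ := mem_filter.1 hM
    · exact hScard
    · exact hSw
    · exact hv
    · exact ⟨u, fun T hT => hu T (mem_filter.2 ⟨mem_univ _, hT⟩), huS⟩
  have hMsub : M ⊆ unions ∪ univ.biUnion F := by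
    intro S hS
    by_cases h : S ∈ unions
    · exact mem_union_left _ h
    · simp only [unions, mem_filter, mem_univ, true_and] at h
      push Not at h
      obtain ⟨v, u, huv, hv, hu⟩ := h
      exact mem_union_right _ (mem_biUnion.2
        ⟨v, mem_univ _, mem_filter.2 ⟨hS, hv, u, huv, hu⟩⟩)
  have hM : #M ≤ (k ^ 4) ^ k * Fintype.card V := by
    have h1 := card_biUnion_le_card_mul univ F _ fun v _ => hFle v
    rw [card_univ] at h1
    have h2 : 2 ^ k + (2 * k * k + 1) ^ k ≤ (k ^ 4) ^ k := by
      calc 2 ^ k + (2 * k * k + 1) ^ k ≤ (2 + (2 * k * k + 1)) ^ k :=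
            pow_add_pow_le (by omega) (by omega) (by omega)
        _ ≤ (k ^ 4) ^ k := Nat.pow_le_pow_left (by
            have : 9 ≤ k * k := Nat.mul_le_mul hk hk
            nlinarith) k
    calc #M ≤ #unions + #(univ.biUnion F) := (card_le_card hMsub).trans (card_union_le _ _)
      _ ≤ 2 ^ k * Fintype.card V + Fintype.card V * (2 * k * k + 1) ^ k :=
          Nat.add_le_add (hunions.trans (Nat.le_mul_of_pos_right _ (by omega))) h1
      _ = (2 ^ k + (2 * k * k + 1) ^ k) * Fintype.card V := by ring
      _ ≤ _ := Nat.mul_le_mul_right _ h2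
  have hncard : {p : Finset (Finset V) | ∃ S : Finset V, p = {S, Sᶜ} ∧
      S.Nonempty ∧ Sᶜ.Nonempty ∧
      lam / ((k : ℝ) - 1) ≤ cutW w S ∧ cutW w S < 2 * lam / k}.ncard ≤ #M := by
    calc _ ≤ ((M.image fun S => ({S, Sᶜ} : Finset (Finset V)) :
          Finset (Finset (Finset V))) : Set (Finset (Finset V))).ncard := by
          refine Set.ncard_le_ncard ?_ (finite_toSet _)
          rintro p ⟨S, rfl, hS, hSc, hl, hu⟩
          rw [mem_coe, mem_image]
          rcases min_le_iff.1 (hshore S hS hSc hl hu) with h | h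
          · exact ⟨S, mem_filter.2 ⟨mem_univ _, h, hu⟩, rfl⟩
          · exact ⟨Sᶜ, mem_filter.2 ⟨mem_univ _, h, by rwa [cutW_compl w hsymm]⟩, by
              rw [compl_compl, pair_comm]⟩
      _ ≤ #M := by rw [Set.ncard_coe_finset]; exact card_image_le
  have hpow : (k : ℝ) ^ ((4 : ℝ) * k) = (((k ^ 4) ^ k : ℕ) : ℝ) := by
    rw [← pow_mul, Nat.cast_pow, ← Real.rpow_natCast]
    push_cast
    rfl
  rw [hpow]
  exact_mod_cast hncard.trans hM
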